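/- Let (X,d) be a metric space, f : X → X a local radial contraction with constant k ∈ (0,1), and γ₀ : [0,1] → X a rectifiable (continuous) path joining x₀ ∈ X to f(x₀). Then for every natural number n, the path fⁿ∘γ₀ is a rectifiable path joining fⁿ(x₀) to fⁿ⁺¹(x₀) with length l(fⁿ∘γ₀) ≤ kⁿ·l(γ₀). -/

import Mathlib

open Set

/-- The length of a path `γ : ℝ → X`, restricted to `[0,1]`, as the supremum over
finite partitions of the sums of distances between consecutive points. -/
noncomputable def pathLength {X : Type*} [MetricSpace X] (γ : ℝ → X) : ENNReal :=
  eVariationOn γ (Set.Icc 0 1)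

/-- `f` is a local radial contraction with constant `k`. -/
def LocalRadialContraction {X : Type*} [MetricSpace X] (f : X → X) (k : ℝ) : Prop :=
  ∀ x : X, ∃ εx > (0 : ℝ), ∀ y : X, dist x y < εx → dist (f x) (f y) ≤ k * dist x y

theorem edist_le_mul_eVariationOn_of_local {E F : Type*} [PseudoEMetricSpace E]
    [PseudoEMetricSpace F] {γ : ℝ → E} {g : ℝ → F} {K : ENNReal} {a b : ℝ} (hab : a ≤ b)
    (h : ∀ c ∈ Icc a b, ∃ δ > (0 : ℝ), ∀ t ∈ Icc a b, |t - c| < δ →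
      edist (g c) (g t) ≤ K * edist (γ c) (γ t)) :
    edist (g a) (g b) ≤ K * eVariationOn γ (Icc a b) := by
  have extend : ∀ s t, a ≤ s → s ≤ t → edist (g a) (g s) ≤ K * eVariationOn γ (Icc a s) →
      edist (g s) (g t) ≤ K * edist (γ s) (γ t) →
      edist (g a) (g t) ≤ K * eVariationOn γ (Icc a t) := by
    intro s t has hst h₁ h₂
    have hadd := eVariationOn.Icc_add_Icc γ (s := univ) has hst (mem_univ s)
    simp only [univ_inter] at hadd
    rw [← hadd, mul_add]
    refine (edist_triangle _ (g s) _).trans (add_le_add h₁ (h₂.trans ?_))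
    gcongr
    exact eVariationOn.edist_le γ ⟨le_rfl, hst⟩ ⟨hst, le_rfl⟩
  set S : Set ℝ := {t ∈ Icc a b | edist (g a) (g t) ≤ K * eVariationOn γ (Icc a t)}
  have haS : a ∈ S := ⟨⟨le_rfl, hab⟩, by simp⟩
  have hbdd : BddAbove S := ⟨b, fun t ht => ht.1.2⟩
  have hc : sSup S ∈ Icc a b := ⟨le_csSup hbdd haS, csSup_le ⟨a, haS⟩ fun t ht => ht.1.2⟩
  obtain ⟨δ, hδ, hloc⟩ := h _ hc
  obtain ⟨s, hsS, hs⟩ := exists_lt_of_lt_csSup ⟨a, haS⟩ (sub_lt_self (sSup S) hδ)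
  have hsc : s ≤ sSup S := le_csSup hbdd hsS
  have hcS : edist (g a) (g (sSup S)) ≤ K * eVariationOn γ (Icc a (sSup S)) := by
    refine extend s _ hsS.1.1 hsc hsS.2 ?_
    rw [edist_comm (g s), edist_comm (γ s)]
    exact hloc s hsS.1 (by rw [abs_lt]; constructor <;> linarith)
  rcases hc.2.eq_or_lt with hcb | hcb
  · rwa [hcb] at hcS
  exfalso
  have hlt : sSup S < min b (sSup S + δ / 2) := lt_min hcb (by linarith)
  have hle : min b (sSup S + δ / 2) ≤ sSup S + δ / 2 := min_le_right _ _
  have hmem : min b (sSup S + δ / 2) ∈ Icc a b := ⟨hc.1.trans hlt.le, min_le_left _ _⟩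
  refine hlt.not_ge (le_csSup hbdd ⟨hmem, extend _ _ hc.1 hlt.le hcS (hloc _ hmem ?_)⟩)
  rw [abs_lt]
  constructor <;> linarith

theorem eVariationOn_Icc_le_mul_of_local {E F : Type*} [PseudoEMetricSpace E]
    [PseudoEMetricSpace F] {γ : ℝ → E} {g : ℝ → F} {K : ENNReal} {a b : ℝ}
    (h : ∀ c ∈ Icc a b, ∃ δ > (0 : ℝ), ∀ t ∈ Icc a b, |t - c| < δ →
      edist (g c) (g t) ≤ K * edist (γ c) (γ t)) :
    eVariationOn g (Icc a b) ≤ K * eVariationOn γ (Icc a b) := by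
  refine iSup_le fun ⟨n, u, hu, hmem⟩ => ?_
  have hsub : ∀ i j, Icc (u i) (u j) ⊆ Icc a b := fun i j =>
    Icc_subset_Icc (hmem i).1 (hmem j).2
  calc ∑ i ∈ Finset.range n, edist (g (u (i + 1))) (g (u i))
      ≤ ∑ i ∈ Finset.range n, K * eVariationOn γ (Icc (u i) (u (i + 1))) := by
        refine Finset.sum_le_sum fun i _ => ?_
        rw [edist_comm]
        refine edist_le_mul_eVariationOn_of_local (hu i.le_succ) fun c hc => ?_
        obtain ⟨δ, hδ, hloc⟩ := h c (hsub _ _ hc)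
        exact ⟨δ, hδ, fun t ht => hloc t (hsub _ _ ht)⟩
    _ = K * eVariationOn γ (Icc (u 0) (u n)) := by
        rw [← Finset.mul_sum, eVariationOn.sum' γ hu]
    _ ≤ K * eVariationOn γ (Icc a b) := by
        gcongr
        exact eVariationOn.mono γ (hsub _ _)

theorem LocalRadialContraction.edist_le {X : Type*} [MetricSpace X] {f : X → X} {k : ℝ}
    (hk : 0 ≤ k) (hf : LocalRadialContraction f k) (x : X) :
    ∃ ε > (0 : ℝ), ∀ y, dist y x < ε → edist (f x) (f y) ≤ ENNReal.ofReal k * edist x y := by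
  obtain ⟨ε, hε, h⟩ := hf x
  refine ⟨ε, hε, fun y hy => ?_⟩
  rw [edist_dist, edist_dist, ← ENNReal.ofReal_mul hk]
  exact ENNReal.ofReal_le_ofReal (h y (by rwa [dist_comm]))

theorem LocalRadialContraction.continuous {X : Type*} [MetricSpace X] {f : X → X} {k : ℝ}
    (hf : LocalRadialContraction f k) : Continuous f := by
  refine continuous_iff_continuousAt.2 fun x => ?_
  obtain ⟨ε, hε, h⟩ := hf x
  refine continuousAt_of_locally_lipschitz hε k fun y hy => ?_
  rw [dist_comm (f y), dist_comm y]
  exact h y (by rwa [dist_comm])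

theorem LocalRadialContraction.pathLength_comp_le {X : Type*} [MetricSpace X] {f : X → X} {k : ℝ}
    (hk : 0 ≤ k) (hf : LocalRadialContraction f k) {γ : ℝ → X} (hγ : ContinuousOn γ (Icc 0 1)) :
    pathLength (fun t => f (γ t)) ≤ ENNReal.ofReal k * pathLength γ := by
  refine eVariationOn_Icc_le_mul_of_local fun c hc => ?_
  obtain ⟨ε, hε, h⟩ := hf.edist_le hk (γ c)
  obtain ⟨δ, hδ, hγδ⟩ := Metric.continuousOn_iff.1 hγ c hc ε hε
  exact ⟨δ, hδ, fun t ht htc => h _ (hγδ t ht htc)⟩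

theorem iterated_path_rectifiable_of_local_radial_contraction
    {X : Type*} [MetricSpace X] (f : X → X) (k : ℝ)
    (hk0 : 0 < k) (hk1 : k < 1) (hf : LocalRadialContraction f k)
    (x₀ : X) (γ₀ : ℝ → X) (hγ : ContinuousOn γ₀ (Set.Icc 0 1))
    (hγ0 : γ₀ 0 = x₀) (hγ1 : γ₀ 1 = f x₀) (hrect : pathLength γ₀ ≠ ⊤) :
    ∀ n : ℕ,
      ContinuousOn (fun t => f^[n] (γ₀ t)) (Set.Icc 0 1) ∧
      f^[n] (γ₀ 0) = f^[n] x₀ ∧ f^[n] (γ₀ 1) = f^[n + 1] x₀ ∧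
      pathLength (fun t => f^[n] (γ₀ t)) ≤ ENNReal.ofReal (k ^ n) * pathLength γ₀ ∧
      pathLength (fun t => f^[n] (γ₀ t)) ≠ ⊤ := by
  intro n
  have hcont : ∀ n : ℕ, ContinuousOn (fun t => f^[n] (γ₀ t)) (Icc 0 1) := fun n =>
    (hf.continuous.iterate n).comp_continuousOn hγ
  have hlen : pathLength (fun t => f^[n] (γ₀ t)) ≤ ENNReal.ofReal (k ^ n) * pathLength γ₀ := by
    induction n with
    | zero => simp
    | succ n ih =>
      simp only [Function.iterate_succ_apply']
      refine (hf.pathLength_comp_le hk0.le (hcont n)).trans ?_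
      rw [pow_succ', ENNReal.ofReal_mul hk0.le, mul_assoc]
      gcongr
  exact ⟨hcont n, by rw [hγ0], by rw [hγ1, Function.iterate_succ_apply], hlen,
    ne_top_of_le_ne_top (ENNReal.mul_ne_top ENNReal.ofReal_ne_top hrect) hlen⟩
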